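/- Every finite interval order that is not a chain is diametrally reversing. That is: let P be a partial order on a finite type that is not a chain, and suppose there exist ℓ, r : P → ℝ with ℓ(v) < r(v) for all v, such that for all x, y: x < y in P if and only if r(x) ≤ ℓ(y). Then P is diametrally reversing. -/

import Mathlib

/-- `L` is a linear extension of the partial order `P`. -/
def IsLinExt {α : Type*} (P : PartialOrder α) (L : LinearOrder α) : Prop :=
  ∀ x y : α, P.le x y → L.le x y

/-- The distance between two linear orders: the number of ordered pairs `(x, y)` with
`x < y` in `L₁` and `y < x` in `L₂`. -/
noncomputable def leDist {α : Type*} (L₁ L₂ : LinearOrder α) : ℕ :=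
  Set.ncard {p : α × α | L₁.lt p.1 p.2 ∧ L₂.lt p.2 p.1}

/-- `(L₁, L₂)` is a diametral pair of linear extensions of `P`. -/
def IsDiametralPair {α : Type*} (P : PartialOrder α) (L₁ L₂ : LinearOrder α) : Prop :=
  IsLinExt P L₁ ∧ IsLinExt P L₂ ∧
    ∀ M₁ M₂ : LinearOrder α, IsLinExt P M₁ → IsLinExt P M₂ →
      leDist M₁ M₂ ≤ leDist L₁ L₂

/-- A linear extension is diametral if it belongs to some diametral pair. -/
def IsDiametral {α : Type*} (P : PartialOrder α) (L : LinearOrder α) : Prop :=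
  ∃ L' : LinearOrder α, IsDiametralPair P L L' ∨ IsDiametralPair P L' L

/-- The linear extension diameter of `P`. -/
noncomputable def led {α : Type*} (P : PartialOrder α) : ℕ :=
  sSup {d : ℕ | ∃ L₁ L₂ : LinearOrder α, IsLinExt P L₁ ∧ IsLinExt P L₂ ∧ leDist L₁ L₂ = d}

/-- `(u, v)` is a critical pair of `P`. -/
def IsCriticalPair {α : Type*} (P : PartialOrder α) (u v : α) : Prop :=
  ¬ P.le u v ∧ ¬ P.le v u ∧ (∀ z, P.lt z u → P.lt z v) ∧ (∀ z, P.lt v z → P.lt u z)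

/-- `L` reverses some critical pair of `P`. -/
def Reverses {α : Type*} (P : PartialOrder α) (L : LinearOrder α) : Prop :=
  ∃ u v : α, IsCriticalPair P u v ∧ L.lt v u

/-- `P` is diametrally reversing: every diametral linear extension reverses a critical pair. -/
def DiametrallyReversing {α : Type*} (P : PartialOrder α) : Prop :=
  ∀ L : LinearOrder α, IsDiametral P L → Reverses P L

/-- `M` is a module of `P`. -/
def IsModuleOf {α : Type*} (P : PartialOrder α) (M : Set α) : Prop :=
  ∀ x, x ∉ M →
    (∀ m ∈ M, P.lt x m) ∨ (∀ m ∈ M, P.lt m x) ∨ (∀ m ∈ M, ¬ P.le x m ∧ ¬ P.le m x)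

/-- `P` is a chain: any two elements are comparable. -/
def IsChainOrder {α : Type*} (P : PartialOrder α) : Prop :=
  ∀ x y : α, P.le x y ∨ P.le y x

section Orders

variable {α : Type*}

theorem LinearOrder.lt_tri (L : LinearOrder α) (x y : α) : L.lt x y ∨ x = y ∨ L.lt y x :=
  @_root_.lt_trichotomy α L x y

theorem LinearOrder.lt_tr (L : LinearOrder α) {x y z : α} (h : L.lt x y) (h' : L.lt y z) :
    L.lt x z :=
  @_root_.lt_trans α L.toPreorder x y z h h'

theorem LinearOrder.lt_irr (L : LinearOrder α) (x : α) : ¬ L.lt x x :=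
  @_root_.lt_irrefl α L.toPreorder x

theorem LinearOrder.lt_asy (L : LinearOrder α) {x y : α} (h : L.lt x y) : ¬ L.lt y x :=
  @_root_.lt_asymm α L.toPreorder x y h

theorem PartialOrder.lt_iff_le_ne (P : PartialOrder α) {x y : α} :
    P.lt x y ↔ P.le x y ∧ x ≠ y :=
  @_root_.lt_iff_le_and_ne α P x y

theorem isLinExt_iff_lt {P : PartialOrder α} {L : LinearOrder α} :
    IsLinExt P L ↔ ∀ x y, P.lt x y → L.lt x y := by
  constructor
  · intro h x y hxy
    obtain ⟨h1, h2⟩ := P.lt_iff_le_ne.1 hxy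
    exact (L.toPartialOrder.lt_iff_le_ne).2 ⟨h x y h1, h2⟩
  · intro h x y hxy
    by_cases he : x = y
    · subst he; exact L.le_refl x
    · exact ((L.toPartialOrder.lt_iff_le_ne).1 (h x y (P.lt_iff_le_ne.2 ⟨hxy, he⟩))).1

/-- The ordered pairs on which two linear orders disagree. -/
def discordant (L₁ L₂ : LinearOrder α) : Set (α × α) :=
  {p | (L₁.lt p.1 p.2 ∧ L₂.lt p.2 p.1) ∨ (L₁.lt p.2 p.1 ∧ L₂.lt p.1 p.2)}

theorem leDist_comm (L₁ L₂ : LinearOrder α) : leDist L₁ L₂ = leDist L₂ L₁ := by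
  have h : {p : α × α | L₂.lt p.1 p.2 ∧ L₁.lt p.2 p.1} =
      Prod.swap '' {p : α × α | L₁.lt p.1 p.2 ∧ L₂.lt p.2 p.1} := by
    rw [Set.image_swap_eq_preimage_swap]
    exact Set.ext fun p => and_comm
  unfold leDist
  rw [h, Set.ncard_image_of_injective _ Prod.swap_injective]

theorem ncard_discordant [Finite α] (L₁ L₂ : LinearOrder α) :
    (discordant L₁ L₂).ncard = 2 * leDist L₁ L₂ := by
  have h : discordant L₁ L₂ = {p : α × α | L₁.lt p.1 p.2 ∧ L₂.lt p.2 p.1} ∪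
      {p : α × α | L₂.lt p.1 p.2 ∧ L₁.lt p.2 p.1} := by
    ext p
    simp only [discordant, Set.mem_ofPred_eq, Set.mem_union]
    tauto
  rw [h, Set.ncard_union_eq]
  · change leDist L₁ L₂ + leDist L₂ L₁ = _
    rw [leDist_comm L₂ L₁]
    ring
  · rw [Set.disjoint_left]
    rintro p ⟨h1, -⟩ ⟨-, h2⟩
    exact L₁.lt_asy h1 h2

theorem IsDiametralPair.symm {P : PartialOrder α} {L₁ L₂ : LinearOrder α}
    (h : IsDiametralPair P L₁ L₂) : IsDiametralPair P L₂ L₁ :=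
  ⟨h.2.1, h.1, fun M₁ M₂ h₁ h₂ => leDist_comm L₁ L₂ ▸ h.2.2 M₁ M₂ h₁ h₂⟩

theorem IsDiametralPair.discordant_subset [Finite α] {P : PartialOrder α}
    {L₁ L₂ M₁ M₂ : LinearOrder α} (h : IsDiametralPair P L₁ L₂) (h₁ : IsLinExt P M₁)
    (h₂ : IsLinExt P M₂) (hsub : discordant L₁ L₂ ⊆ discordant M₁ M₂) :
    discordant M₁ M₂ ⊆ discordant L₁ L₂ := by
  refine (Set.eq_of_subset_of_ncard_le hsub ?_ (Set.toFinite _)).ge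
  rw [ncard_discordant, ncard_discordant]
  exact Nat.mul_le_mul_left 2 (h.2.2 M₁ M₂ h₁ h₂)

/-- The element `g` of a linear order can be moved to the position directly above the initial
segment `A`. -/
theorem exists_linearOrder_move (L : LinearOrder α) (g : α) (A : Set α)
    (hA : ∀ x y, L.lt x y → y ∈ A → x ∈ A) :
    ∃ M : LinearOrder α, (∀ x y, x ≠ g → y ≠ g → (M.lt x y ↔ L.lt x y)) ∧
      ∀ x, x ≠ g → (M.lt x g ↔ x ∈ A) ∧ (M.lt g x ↔ x ∉ A) := by
  classical
  let f : α → ℕ ×ₗ α := fun x => toLex (if x = g then 1 else if x ∈ A then 0 else 2, x)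
  have hf : Function.Injective f := fun x y h => congrArg (fun p => (ofLex p).2) h
  refine ⟨LinearOrder.lift' f hf, ?_, ?_⟩
  · intro x y hx hy
    change f x < f y ↔ _
    simp only [f, Prod.Lex.toLex_lt_toLex, if_neg hx, if_neg hy]
    change _ ∨ _ ∧ L.lt x y ↔ L.lt x y
    have h1 := hA x y
    have h2 := hA y x
    have h3 := L.lt_tri x y
    by_cases h4 : x ∈ A <;> by_cases h5 : y ∈ A <;> simp [h4, h5] at h1 h2 ⊢
    · rcases h3 with h3 | rfl | h3
      · exact h3
      · exact absurd h4 h5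
      · exact absurd h3 (not_lt_of_ge h2)
    · exact h1
  · intro x hx
    change (f x < f g ↔ _) ∧ (f g < f x ↔ _)
    simp only [f, Prod.Lex.toLex_lt_toLex, if_neg hx, if_true]
    by_cases h4 : x ∈ A <;> simp [h4]

/-- If moving `g` down to directly above `A` in one member of a diametral pair and up to the top
of `B` in the other loses no discordant pair, then it gains none. -/
theorem IsDiametralPair.discordant_of_move [Finite α] {P : PartialOrder α} {L L' : LinearOrder α}
    (h : IsDiametralPair P L L') (g : α) (A B : Set α)
    (hA : ∀ x y, L.lt x y → y ∈ A → x ∈ A) (hgA : g ∉ A)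
    (hB : ∀ x y, L'.lt x y → y ∈ B → x ∈ B) (hgB : g ∈ B)
    (hpred : ∀ x, P.lt x g → x ∈ A) (hsucc : ∀ x, P.lt g x → x ∉ B)
    (hD : ∀ x, L.lt x g → x ∉ A → x ∈ B) (hAB : ∀ x ∈ A, x ∈ B → L'.lt x g)
    {x : α} (hxA : x ∉ A) (hxB : x ∈ B) (hx : x ≠ g) :
    (L.lt x g ∧ L'.lt g x) ∨ (L.lt g x ∧ L'.lt x g) := by
  have hL := isLinExt_iff_lt.1 h.1
  have hL' := isLinExt_iff_lt.1 h.2.1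
  obtain ⟨M, hM, hMg⟩ := exists_linearOrder_move L g A hA
  obtain ⟨M', hM', hMg'⟩ := exists_linearOrder_move L' g B hB
  have hAg : ∀ y ∈ A, L.lt y g := by
    intro y hy
    rcases L.lt_tri y g with h1 | rfl | h1
    · exact h1
    · exact absurd hy hgA
    · exact absurd (hA _ _ h1 hy) hgA
  have e1 : IsLinExt P M := by
    refine isLinExt_iff_lt.2 fun y z hyz => ?_
    have hne := (P.lt_iff_le_ne.1 hyz).2
    by_cases hy : y = g
    · subst hy
      exact (hMg z hne.symm).2.2 fun hz => L.lt_asy (hAg z hz) (hL _ _ hyz)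
    by_cases hz : z = g
    · subst hz
      exact (hMg y hy).1.2 (hpred y hyz)
    exact (hM y z hy hz).2 (hL _ _ hyz)
  have e2 : IsLinExt P M' := by
    refine isLinExt_iff_lt.2 fun y z hyz => ?_
    have hne := (P.lt_iff_le_ne.1 hyz).2
    by_cases hy : y = g
    · subst hy
      exact (hMg' z hne.symm).2.2 (hsucc z hyz)
    by_cases hz : z = g
    · subst hz
      exact (hMg' y hy).1.2 (hB _ _ (hL' _ _ hyz) hgB)
    exact (hM' y z hy hz).2 (hL' _ _ hyz)
  have key : ∀ y, y ≠ g → (L.lt y g ∧ L'.lt g y) ∨ (L.lt g y ∧ L'.lt y g) →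
      (M.lt y g ∧ M'.lt g y) ∨ (M.lt g y ∧ M'.lt y g) := by
    intro y hy hd
    rw [(hMg y hy).1, (hMg y hy).2, (hMg' y hy).1, (hMg' y hy).2]
    by_cases hyA : y ∈ A
    · rcases hd with ⟨-, h2⟩ | ⟨h1, -⟩
      · exact Or.inl ⟨hyA, fun hyB => L'.lt_asy h2 (hAB y hyA hyB)⟩
      · exact absurd h1 (L.lt_asy (hAg y hyA))
    · rcases hd with ⟨h1, -⟩ | ⟨-, h2⟩
      · exact Or.inr ⟨hyA, hD y h1 hyA⟩
      · exact Or.inr ⟨hyA, hB _ _ h2 hgB⟩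
  have hsub : discordant L L' ⊆ discordant M M' := by
    rintro ⟨y, z⟩ hyz
    simp only [discordant, Set.mem_ofPred_eq] at hyz ⊢
    by_cases hy : y = g
    · by_cases hz : z = g
      · subst hy hz
        exact absurd hyz (by simp [L.lt_irr])
      · subst hy
        have := key z hz (by tauto)
        tauto
    by_cases hz : z = g
    · subst hz
      exact key y hy hyz
    · rwa [hM y z hy hz, hM z y hz hy, hM' y z hy hz, hM' z y hz hy]
  exact h.discordant_subset e1 e2 hsub (a := (x, g))
    (Or.inr ⟨(hMg x hx).2.2 hxA, (hMg' x hx).1.2 hxB⟩)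

theorem exists_lt_not_lt_of_not_reverses {P : PartialOrder α} {L : LinearOrder α}
    (hL : IsLinExt P L) (hrev : ¬ Reverses P L) {g b : α} (hbg : L.lt b g) (hnlt : ¬ P.lt b g)
    (hpred : ∀ z, P.lt z g → P.lt z b) : ∃ w, P.lt b w ∧ ¬ P.lt g w := by
  by_contra hcon
  push Not at hcon
  have hne : b ≠ g := fun h => L.lt_irr g (h ▸ hbg)
  refine hrev ⟨g, b, ⟨fun h => ?_, fun h => hnlt (P.lt_iff_le_ne.2 ⟨h, hne⟩), hpred, hcon⟩, hbg⟩
  exact L.lt_asy hbg (isLinExt_iff_lt.1 hL _ _ (P.lt_iff_le_ne.2 ⟨h, hne.symm⟩))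

end Orders

/-- Every finite interval order which is not a chain is diametrally reversing. -/
theorem statement_11 {α : Type*} [Fintype α] (P : PartialOrder α)
    (hchain : ¬ IsChainOrder P) (l r : α → ℝ) (hlr : ∀ v, l v < r v)
    (hrep : ∀ x y : α, P.lt x y ↔ r x ≤ l y) :
    DiametrallyReversing P := by
  rintro L ⟨L', hpair⟩
  by_contra hrev
  replace hpair : IsDiametralPair P L L' := hpair.elim id IsDiametralPair.symm
  have hL := isLinExt_iff_lt.1 hpair.1
  have hL' := isLinExt_iff_lt.1 hpair.2.1
  -- `a` is the first element of `L` that is incomparable to some element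
  obtain ⟨a, ⟨w₀, haw₀, hw₀a⟩, hamin⟩ : ∃ a, (∃ w, ¬ P.le a w ∧ ¬ P.le w a) ∧
      ∀ b, L.lt b a → ∀ w, P.le b w ∨ P.le w b := by
    have hne : {a | ∃ w, ¬ P.le a w ∧ ¬ P.le w a}.Nonempty := by
      simp only [IsChainOrder, not_forall, not_or] at hchain
      exact hchain
    have hwf : WellFounded L.lt := (@Finite.to_wellFoundedLT α _ L.toPreorder).wf
    refine ⟨hwf.min _ hne, hwf.min_mem _ hne, fun b hb w => ?_⟩
    by_contra hcon
    exact hwf.not_lt_min (s := {a | ∃ w, ¬ P.le a w ∧ ¬ P.le w a}) (x := b)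
      ⟨w, not_or.1 hcon⟩ hb
  set S : Set α := {s | L.lt s a}
  have hSlt : ∀ s ∈ S, ∀ y ∉ S, P.lt s y := by
    intro s hs y hy
    have hsy : L.lt s y := by
      rcases L.lt_tri y a with h | rfl | h
      · exact absurd h hy
      · exact hs
      · exact L.lt_tr hs h
    have hne : s ≠ y := fun h => hy (h ▸ hs)
    rcases hamin s hs y with h | h
    · exact P.lt_iff_le_ne.2 ⟨h, hne⟩
    · exact absurd (hL _ _ (P.lt_iff_le_ne.2 ⟨h, hne.symm⟩)) (L.lt_asy hsy)
  have haS : a ∉ S := L.lt_irr a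
  -- the minimal elements of the complement of `S`
  set N : Set α := {x | x ∉ S ∧ ∀ y, P.lt y x → y ∈ S}
  have hNbelow : ∀ e ∉ S, e ∉ N → ∃ m ∈ N, P.lt m e := by
    have hwf : WellFounded P.lt := (@Finite.to_wellFoundedLT α _ P.toPreorder).wf
    intro e
    induction e using hwf.induction with
    | _ e ih =>
      intro heS heN
      obtain ⟨y, hye, hyS⟩ : ∃ y, P.lt y e ∧ y ∉ S := by
        by_contra hcon
        push Not at hcon
        exact heN ⟨heS, hcon⟩
      by_cases hyN : y ∈ N
      · exact ⟨y, hyN, hye⟩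
      · obtain ⟨m, hm, hmy⟩ := ih y hye hyS hyN
        exact ⟨m, hm, @lt_trans α P.toPreorder _ _ _ hmy hye⟩
  have haN : a ∈ N := ⟨haS, fun y hy => hL _ _ hy⟩
  obtain ⟨c, hcN, hcmaxFor⟩ := (Set.toFinite N).exists_maximalFor r N ⟨a, haN⟩
  have hcmax : ∀ m ∈ N, r m ≤ r c := fun m hm =>
    (le_total (r m) (r c)).elim id fun h => hcmaxFor hm h
  have hNc : ∀ m ∈ N, m ≠ c → L.lt m c := by
    intro m hm hmc
    rcases L.lt_tri m c with h | h | h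
    · exact h
    · exact absurd h hmc
    · obtain ⟨w, hw1, hw2⟩ := exists_lt_not_lt_of_not_reverses hpair.1 hrev h
        (fun hcm => hcN.1 (hm.2 c hcm)) (fun z hz => hSlt z (hm.2 z hz) c hcN.1)
      rw [hrep] at hw1 hw2
      linarith [hcmax m hm]
  set D : Set α := {b | b ∉ S ∧ L.lt b c}
  have hDsucc : ∀ b ∈ D, ∃ w, P.lt b w ∧ ¬ P.lt c w := fun b hb =>
    exists_lt_not_lt_of_not_reverses hpair.1 hrev hb.2 (fun h => hb.1 (hcN.2 b h))
      fun z hz => hSlt z (hcN.2 z hz) b hb.1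
  have hDr : ∀ b ∈ D, r b < r c := by
    intro b hb
    obtain ⟨w, h1, h2⟩ := hDsucc b hb
    rw [hrep] at h1 h2
    linarith
  have hDne : D.Nonempty := by
    have hw₀S : w₀ ∉ S := fun h => (hamin w₀ h a).elim hw₀a haw₀
    obtain ⟨m, hm, hma⟩ : ∃ m ∈ N, m ≠ a := by
      by_cases hw : w₀ ∈ N
      · exact ⟨w₀, hw, fun h => haw₀ (h ▸ P.le_refl w₀)⟩
      · obtain ⟨m, hm, hmw⟩ := hNbelow w₀ hw₀S hw
        exact ⟨m, hm, fun h => haw₀ (P.lt_iff_le_ne.1 (h ▸ hmw)).1⟩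
    by_cases hac : a = c
    · exact ⟨m, hm.1, hNc m hm (hac ▸ hma)⟩
    · exact ⟨a, haS, hNc a haN hac⟩
  -- moving `c` shows that `S ∪ D ∪ {c}` is an initial segment of `L'` as well
  have hmove := fun x => hpair.discordant_of_move c S
    {x | ¬ L'.lt c x ∨ ∃ d ∈ D, ¬ L'.lt d x}
    (fun x y hxy hy => L.lt_tr hxy hy) hcN.1
    (by
      rintro x y hxy (h | ⟨d, hd, h⟩)
      · exact Or.inl fun h' => h (L'.lt_tr h' hxy)
      · exact Or.inr ⟨d, hd, fun h' => h (L'.lt_tr h' hxy)⟩)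
    (Or.inl (L'.lt_irr c)) hcN.2
    (by
      rintro x hx (h | ⟨d, hd, h⟩)
      · exact h (hL' _ _ hx)
      · refine h (hL' _ _ ?_)
        rw [hrep] at hx ⊢
        linarith [hDr d hd])
    (fun x hx hxS => Or.inr ⟨x, ⟨hxS, hx⟩, L'.lt_irr x⟩)
    (fun x hx _ => hL' _ _ (hSlt x hx c hcN.1)) (x := x)
  have hcD : ∀ d ∈ D, L'.lt c d := by
    intro d hd
    have hne : d ≠ c := fun h => L.lt_irr c (h ▸ hd.2)
    rcases hmove _ hd.1 (Or.inr ⟨d, hd, L'.lt_irr d⟩) hne with h | h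
    · exact h.2
    · exact absurd h.1 (L.lt_asy hd.2)
  have hafter : ∀ e, L.lt c e → L'.lt c e ∧ ∀ d ∈ D, L'.lt d e := by
    intro e he
    by_contra hcon
    have heS : e ∉ S := fun h => hcN.1 (L.lt_tr he h)
    have hec : e ≠ c := fun h => L.lt_irr c (h ▸ he)
    have heN : e ∉ N := fun h => L.lt_asy he (hNc e h hec)
    have hB : ¬ L'.lt c e ∨ ∃ d ∈ D, ¬ L'.lt d e := by
      by_contra h
      push Not at h
      exact hcon h
    rcases hmove _ heS hB hec with h | ⟨-, h⟩
    · exact L.lt_asy he h.1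
    · obtain ⟨m, hm, hme⟩ := hNbelow e heS heN
      have hme' := hL' _ _ hme
      by_cases hmc : m = c
      · exact L'.lt_asy h (hmc ▸ hme')
      · exact L'.lt_asy h (L'.lt_tr (hcD m ⟨hm.1, hNc m hm hmc⟩) hme')
  have hinit : ∀ x, L.lt x c → ∀ e, L.lt c e → L'.lt x e := by
    intro x hx e he
    by_cases hxS : x ∈ S
    · exact hL' _ _ (hSlt x hxS e fun h => hcN.1 (L.lt_tr he h))
    · exact (hafter e he).2 x ⟨hxS, hx⟩
  -- some element above `c` in `L` is incomparable to `c`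
  obtain ⟨w, hcw, hw⟩ : ∃ w, L.lt c w ∧ l w < r c := by
    obtain ⟨b, hb⟩ := (Set.toFinite D).exists_maximalFor r D hDne
    obtain ⟨w, h1, h2⟩ := hDsucc b hb.1
    refine ⟨w, ?_, not_le.1 fun h => h2 ((hrep _ _).2 h)⟩
    rcases L.lt_tri c w with h | h | h
    · exact h
    · exact absurd (hcN.2 b (h ▸ h1)) hb.1.1
    · exfalso
      have hwD : w ∈ D := ⟨fun hw => hb.1.1 (L.lt_tr (hL _ _ h1) hw), h⟩
      rw [hrep] at h1
      have := hlr w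
      linarith [hb.2 hwD (by linarith)]
  obtain ⟨g, hg⟩ := (Set.toFinite {x | L.lt c x}).exists_minimalFor l _ ⟨w, hcw⟩
  have hcg : L.lt c g := hg.1
  have hgmin : ∀ x, L.lt c x → l g ≤ l x := fun x hx =>
    (le_total (l g) (l x)).elim id fun h => hg.2 hx h
  have hncg : ¬ P.lt c g := fun h => by
    rw [hrep] at h
    linarith [hgmin w hcw]
  have hnot : ∀ b, L.lt c b → ¬ P.lt b g := fun b hb h => by
    rw [hrep] at h
    linarith [hgmin b hb, hlr b]
  have hr : ∀ b, L.lt c b → L.lt b g → r b < r g := by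
    intro b hb hbg
    obtain ⟨z, h1, h2⟩ := exists_lt_not_lt_of_not_reverses hpair.1 hrev hbg (hnot b hb)
      fun z hz => by
        rw [hrep] at hz ⊢
        linarith [hgmin b hb]
    rw [hrep] at h1 h2
    linarith
  have hcg' : L'.lt c g := (hafter g hcg).1
  have hc := hpair.discordant_of_move g {x | L.lt x c}
    {x | ¬ L'.lt g x ∨ ∃ d, L.lt c d ∧ L.lt d g ∧ ¬ L'.lt d x}
    (fun x y hxy hy => L.lt_tr hxy hy) (L.lt_asy hcg)
    (by
      rintro x y hxy (h | ⟨d, hd, hd', h⟩)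
      · exact Or.inl fun h' => h (L'.lt_tr h' hxy)
      · exact Or.inr ⟨d, hd, hd', fun h' => h (L'.lt_tr h' hxy)⟩)
    (Or.inl (L'.lt_irr g))
    (by
      intro x hx
      rcases L.lt_tri x c with h | rfl | h
      · exact h
      · exact absurd hx hncg
      · exact absurd hx (hnot x h))
    (by
      rintro x hx (h | ⟨d, hd, hd', h⟩)
      · exact h (hL' _ _ hx)
      · refine h (hL' _ _ ?_)
        rw [hrep] at hx ⊢
        linarith [hr d hd hd'])
    (by
      intro x hx hxc
      rcases L.lt_tri x c with h | rfl | h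
      · exact absurd h hxc
      · exact Or.inl (L'.lt_asy hcg')
      · exact Or.inr ⟨x, h, hx, L'.lt_irr x⟩)
    (fun x hx _ => hinit x hx g hcg) (x := c) (L.lt_irr c) (Or.inl (L'.lt_asy hcg'))
    (fun h => L.lt_irr g (h ▸ hcg))
  rcases hc with h | h
  · exact L'.lt_asy hcg' h.2
  · exact L.lt_asy hcg h.1
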